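/- arXiv:2212.04463 — 4 statements merged into one kernel-verified Lean document; each statement's English description precedes it below -/
import Mathlib

section
/- Let N and k be positive integers with N > 1, and let f be a monic polynomial of degree k in (ℤ/Nℤ)[x]. Suppose F is a positive integer with F ∣ N^k − 1 and F > √N. Suppose there exists g ∈ (ℤ/Nℤ)[x] such that, in the quotient ring (ℤ/Nℤ)[x]/(f): (1) g^F = 1; (2) for each prime q dividing F, the element g^{F/q} − 1 (reduced modulo f to a representative of degree < k) and f generate the unit ideal of (ℤ/Nℤ)[x] (i.e. gcd(g^{F/q} − 1, f) = 1); and (3) for every 1 ≤ i ≤ k, the i-th elementary symmetric polynomial evaluated at the k elements g^{N^j}, 0 ≤ j ≤ k−1, of (ℤ/Nℤ)[x]/(f) lies in the image of ℤ/Nℤ (i.e. is represented by a constant polynomial). If moreover none of the residues of N^j mod F (taken in {0,…,F−1}) for 0 ≤ j ≤ k−1 is a proper divisor of N (a divisor r with 1 < r < N), then N is prime. -/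
open Polynomial

/-- If all elementary symmetric functions of `s` are fixed by the `p`-power map, then the
`p`-power map sends elements of `s` to elements of `s`. -/
theorem Multiset.pow_char_mem_of_esymm_pow_char {K : Type*} [Field K] (p : ℕ) [Fact p.Prime]
    [CharP K p] (s : Multiset K) (hs : ∀ i, 1 ≤ i → i ≤ s.card → s.esymm i ^ p = s.esymm i)
    {x : K} (hx : x ∈ s) : x ^ p ∈ s := by
  set P : K[X] := (s.map fun t => X - C t).prod with hP
  have hroots : P.roots = s := roots_multiset_prod_X_sub_C s
  have hmonic : P.Monic := monic_multiset_prod_of_monic _ _ fun t _ => monic_X_sub_C t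
  have hfix : P.map (frobenius K p) = P := by
    ext i
    rw [coeff_map]
    rcases lt_or_ge s.card i with hi | hi
    · have : P.coeff i = 0 := coeff_eq_zero_of_natDegree_lt (by
        rwa [hP, natDegree_multiset_prod_X_sub_C_eq_card])
      simp [this]
    · rw [hP, Multiset.prod_X_sub_C_coeff s hi, map_mul, map_pow, map_neg, map_one]
      congr 1
      rcases Nat.eq_zero_or_pos (s.card - i) with h0 | h0
      · simp [h0, Multiset.esymm]
      · exact hs _ h0 (Nat.sub_le _ _)
  have hx0 : P.eval x = 0 := by
    rw [← hroots] at hx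
    exact (mem_roots'.mp hx).2
  rw [← hroots, mem_roots hmonic.ne_zero, IsRoot, ← hfix, ← frobenius_def, eval_map_apply, hx0]
  exact _root_.map_zero _

theorem Multiset.map_esymm_ringHom {R S : Type*} [CommSemiring R] [CommSemiring S] (φ : R →+* S)
    (s : Multiset R) (n : ℕ) : φ (s.esymm n) = (s.map φ).esymm n := by
  simp [Multiset.esymm, map_multiset_sum, map_multiset_prod, Multiset.powersetCard_map]

theorem ZMod.ringHom_apply_pow_char {N : ℕ} {K : Type*} [Field K] (p : ℕ) [Fact p.Prime]
    [CharP K p] (ψ : ZMod N →+* K) (c : ZMod N) : ψ c ^ p = ψ c := by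
  obtain ⟨n, rfl⟩ := ZMod.intCast_surjective c
  rw [map_intCast, ← frobenius_def, map_intCast]

/-- Lenstra's Finite Fields primality criterion. -/
theorem lenstra_finite_fields_test
    (N k F : ℕ) (hN : 1 < N) (hk : 0 < k) (hF : 0 < F)
    (f : Polynomial (ZMod N)) (hmonic : f.Monic) (hdeg : f.natDegree = k)
    (hFdvd : F ∣ N ^ k - 1) (hFbig : N < F ^ 2)
    (g : Polynomial (ZMod N))
    (h1 : (Ideal.Quotient.mk (Ideal.span {f}) g) ^ F = 1)
    (h2 : ∀ q : ℕ, q.Prime → q ∣ F →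
      IsCoprime ((g ^ (F / q) - 1) %ₘ f) f)
    (h3 : ∀ i : ℕ, 1 ≤ i → i ≤ k →
      ∃ c : ZMod N,
        (((Finset.range k).val.map
            (fun j => (Ideal.Quotient.mk (Ideal.span {f}) g) ^ (N ^ j))).esymm i)
          = Ideal.Quotient.mk (Ideal.span {f}) (Polynomial.C c))
    (h4 : ∀ j < k, ¬ (1 < N ^ j % F ∧ N ^ j % F < N ∧ (N ^ j % F) ∣ N)) :
    N.Prime := by
  by_contra hprime
  set p := N.minFac with hp
  have hpp : p.Prime := Nat.minFac_prime hN.ne'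
  have : Fact p.Prime := ⟨hpp⟩
  have hpN : p ∣ N := N.minFac_dvd
  have hpsq : p ^ 2 ≤ N := Nat.minFac_sq_le_self (by omega) hprime
  have hpF : p < F := lt_of_pow_lt_pow_left₀ 2 hF.le (hpsq.trans_lt hFbig)
  have hplt : p < N := by nlinarith [hpp.two_le]
  -- a root `a` of `f` in an algebraic closure of `ZMod p` gives a point of the quotient ring
  let K := AlgebraicClosure (ZMod p)
  have : CharP K p := charP_of_injective_algebraMap (algebraMap (ZMod p) K).injective p
  let ψ : ZMod N →+* K := (algebraMap (ZMod p) K).comp (ZMod.castHom hpN (ZMod p))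
  obtain ⟨a, ha⟩ : ∃ a : K, (f.map ψ).IsRoot a := by
    refine IsAlgClosed.exists_root _ (ne_of_gt (natDegree_pos_iff_degree_pos.mp ?_))
    rwa [hmonic.natDegree_map, hdeg]
  have haf : f.eval₂ ψ a = 0 := by rwa [IsRoot, eval_map] at ha
  let φ : (ZMod N)[X] ⧸ Ideal.span {f} →+* K :=
    Ideal.Quotient.lift (Ideal.span {f}) (eval₂RingHom ψ a) (by
      intro b hb
      obtain ⟨c, rfl⟩ := Ideal.mem_span_singleton.mp hb
      simp [eval₂_mul, haf])
  have hφ : ∀ b, φ (Ideal.Quotient.mk (Ideal.span {f}) b) = b.eval₂ ψ a := fun b => rfl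
  set ζ : K := g.eval₂ ψ a with hζ
  have horder : orderOf ζ = F := by
    refine orderOf_eq_of_pow_and_pow_div_prime hF ?_ fun q hq hqF hone => ?_
    · rw [hζ, ← hφ, ← map_pow, h1, map_one]
    · obtain ⟨u, v, huv⟩ := h2 q hq hqF
      have hmod : ((g ^ (F / q) - 1) %ₘ f).eval₂ ψ a = 0 := by
        rw [modByMonic_eq_sub_mul_div, eval₂_sub, eval₂_mul, haf, zero_mul, sub_zero, eval₂_sub,
          eval₂_pow, eval₂_one, ← hζ, hone, sub_self]
      have := congrArg (eval₂ ψ a) huv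
      simp [eval₂_add, eval₂_mul, hmod, haf] at this
  -- the `p`-power map permutes the conjugates `ζ ^ N ^ j`
  have hmem : ζ ^ p ∈ (Finset.range k).val.map fun j => ζ ^ N ^ j := by
    refine Multiset.pow_char_mem_of_esymm_pow_char p _ (fun i hi hik => ?_)
      (Multiset.mem_map.mpr ⟨0, by simpa using hk, by simp⟩)
    obtain ⟨c, hc⟩ := h3 i hi (by simpa using hik)
    have hc' := congrArg φ hc
    rw [Multiset.map_esymm_ringHom, Multiset.map_map, hφ, eval₂_C] at hc'
    simp only [Function.comp_def, map_pow, hφ, ← hζ] at hc'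
    rw [hc', ZMod.ringHom_apply_pow_char]
  obtain ⟨j, hj, hjp⟩ := Multiset.mem_map.mp hmem
  have hmodF : N ^ j % F = p := by
    have hfin : IsOfFinOrder ζ := orderOf_pos_iff.mp (horder ▸ hF)
    have := hfin.pow_eq_pow_iff_modEq.mp hjp
    rwa [horder, Nat.ModEq, Nat.mod_eq_of_lt hpF] at this
  refine h4 j (by simpa using hj) ?_
  rw [hmodF]
  exact ⟨hpp.one_lt, hplt, hpN⟩
end

section
/- Let R be a Dedekind domain, M an R-module, and P ∈ M with P ≠ 0. Let 𝔞 be a nonzero ideal of R such that λ • P = 0 for every λ ∈ 𝔞, and suppose that for each prime ideal 𝔥 dividing 𝔞 there exists an element λ ∈ 𝔞·𝔥⁻¹ with λ • P ≠ 0. Then for all λ ∈ R, λ • P = 0 if and only if λ ∈ 𝔞 (that is, the annihilator of P equals 𝔞). -/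
/-- The annihilator of `P` equals `𝔞` (Lemma on annihilators over Dedekind domains). -/
theorem annihilator_eq_of_prime_steps
    {R : Type*} [CommRing R] [IsDomain R] [IsDedekindDomain R]
    {M : Type*} [AddCommGroup M] [Module R M]
    (P : M) (hP : P ≠ 0) (a : Ideal R) (ha : a ≠ ⊥)
    (hann : ∀ lam ∈ a, lam • P = 0)
    (hstep : ∀ h : Ideal R, h.IsPrime → h ∣ a →
      ∀ b : Ideal R, b * h = a → ∃ lam ∈ b, lam • P ≠ 0) :
    ∀ lam : R, lam • P = 0 ↔ lam ∈ a := by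
  have hle : a ≤ Ideal.torsionOf R M P := fun x hx => hann x hx
  obtain ⟨c, hc⟩ := Ideal.dvd_iff_le.mpr hle
  have hc_top : c = ⊤ := by
    by_contra hne
    obtain ⟨h, hmax, hch⟩ := Ideal.exists_le_maximal c hne
    obtain ⟨d, rfl⟩ := Ideal.dvd_iff_le.mpr hch
    have hmul : Ideal.torsionOf R M P * d * h = a := by rw [hc]; ring
    obtain ⟨x, hx, hxP⟩ := hstep h hmax.isPrime (Dvd.intro_left _ hmul) _ hmul
    exact hxP (Ideal.mul_le_left hx)
  intro lam
  rw [hc, hc_top, Ideal.mul_top, Ideal.mem_torsionOf_iff]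
end

section
/- Let K = ℚ(√d) with d < 0 a squarefree integer, with ring of integers O_K, and let |·| denote the field norm N_{K/ℚ} (so |a + b√d| = a² − d·b² ≥ 0). Let ι, β, X ∈ O_K be any elements. If |X| ≥ 4(−d) + 4d² and |β| ≤ (−d + d²)·|ι|, then |ιX + β| ≥ |ι|. -/
open NumberField

/-- In a quadratic number field containing a square root of a negative integer, the norm of an
element is the squared absolute value of its image under any complex embedding. -/
theorem norm_eq_normSq_of_sq_eq_neg
    {K : Type*} [Field K] [NumberField K]
    {d : ℤ} (hd : d < 0) {s : K} (hs : s ^ 2 = (d : K))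
    (hdeg : Module.finrank ℚ K = 2) (φ : K →ₐ[ℚ] ℂ) (x : K) :
    ((Algebra.norm ℚ x : ℚ) : ℝ) = Complex.normSq (φ x) := by
  classical
  let ψ : K →ₐ[ℚ] ℂ := (Complex.conjAe.restrictScalars ℚ).toAlgHom.comp φ
  have hψ (y : K) : ψ y = starRingEnd ℂ (φ y) := rfl
  have hne : φ ≠ ψ := by
    intro h
    have hreal : starRingEnd ℂ (φ s) = φ s := by rw [← hψ, ← h]
    obtain ⟨r, hr⟩ := Complex.conj_eq_iff_real.mp hreal
    have hφ : φ s ^ 2 = (d : ℂ) := by rw [← map_pow, hs, map_intCast]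
    rw [hr] at hφ
    have hrd : r ^ 2 = (d : ℝ) := by exact_mod_cast hφ
    have hdR : (d : ℝ) < 0 := by exact_mod_cast hd
    nlinarith [sq_nonneg r]
  have huniv : (Finset.univ : Finset (K →ₐ[ℚ] ℂ)) = {φ, ψ} := by
    symm
    apply Finset.eq_univ_of_card
    rw [Finset.card_pair hne, AlgHom.card, hdeg]
  have hprod := Algebra.norm_eq_prod_embeddings ℚ ℂ x
  rw [huniv, Finset.prod_pair hne, hψ, Complex.mul_conj] at hprod
  rw [eq_ratCast] at hprod
  exact_mod_cast hprod

/-- If `‖x‖² ≥ 4c` and `‖b‖² ≤ c‖a‖²` with `c ≥ 1`, then `‖a‖ ≤ ‖a * x + b‖`. -/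
theorem norm_le_norm_mul_add {F : Type*} [NormedField F] {a b x : F} {c : ℝ} (hc : 1 ≤ c)
    (hx : 4 * c ≤ ‖x‖ ^ 2) (hb : ‖b‖ ^ 2 ≤ c * ‖a‖ ^ 2) : ‖a‖ ≤ ‖a * x + b‖ := by
  have hsqrt : √c ^ 2 = c := Real.sq_sqrt (by linarith)
  have hsqrt_one : 1 ≤ √c := Real.one_le_sqrt.mpr hc
  have hx' : 2 * √c ≤ ‖x‖ := abs_le_of_sq_le_sq' (by nlinarith) (norm_nonneg x) |>.2
  have hb' : ‖b‖ ≤ √c * ‖a‖ :=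
    abs_le_of_sq_le_sq' (by rw [mul_pow, hsqrt]; exact hb) (by positivity) |>.2
  have htri : ‖a‖ * ‖x‖ - ‖b‖ ≤ ‖a * x + b‖ := by
    simpa using norm_sub_norm_le (a * x) (-b)
  nlinarith [mul_le_mul_of_nonneg_left hx' (norm_nonneg a),
    mul_le_mul_of_nonneg_left hsqrt_one (norm_nonneg a)]

/-- Norm bound lemma: if `|X| ≥ 4(-d) + 4d²` and `|β| ≤ (-d + d²)|ι|` in the ring of
integers of `K = ℚ(√d)` (`d < 0` squarefree), then `|ιX + β| ≥ |ι|`. -/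
theorem norm_mul_add_ge
    {K : Type*} [Field K] [NumberField K]
    (d : ℤ) (hd : d < 0) (hsf : Squarefree d)
    (sqrtd : K) (hsq : sqrtd ^ 2 = (d : K))
    (hdeg : Module.finrank ℚ K = 2)
    (ι β X : 𝓞 K)
    (hX : 4 * (-d) + 4 * d ^ 2 ≤ Algebra.norm ℤ X)
    (hβ : Algebra.norm ℤ β ≤ (-d + d ^ 2) * Algebra.norm ℤ ι) :
    Algebra.norm ℤ ι ≤ Algebra.norm ℤ (ι * X + β) := by
  let φ : K →ₐ[ℚ] ℂ := IsAlgClosed.lift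
  have hnorm (y : 𝓞 K) : ((Algebra.norm ℤ y : ℤ) : ℝ) = ‖φ y‖ ^ 2 := by
    rw [← Complex.normSq_eq_norm_sq, ← norm_eq_normSq_of_sq_eq_neg hd hsq hdeg φ,
      ← Algebra.coe_norm_int, Rat.cast_intCast]
  have hc : (1 : ℝ) ≤ -d + d ^ 2 := by
    have : 1 ≤ -d + d ^ 2 := by nlinarith
    exact_mod_cast this
  have hX' : 4 * (-d + d ^ 2 : ℝ) ≤ ‖φ X‖ ^ 2 := by
    rw [← hnorm, mul_add]
    exact_mod_cast hX
  have hβ' : ‖φ β‖ ^ 2 ≤ (-d + d ^ 2 : ℝ) * ‖φ ι‖ ^ 2 := by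
    rw [← hnorm, ← hnorm]
    exact_mod_cast hβ
  have hmain : ((Algebra.norm ℤ ι : ℤ) : ℝ) ≤ (Algebra.norm ℤ (ι * X + β) : ℤ) := by
    rw [hnorm, hnorm, RingOfIntegers.coe_eq_algebraMap (ι * X + β), map_add, map_mul, map_add,
      map_mul]
    gcongr
    exact norm_le_norm_mul_add hc hX' hβ'
  exact_mod_cast hmain
end

section
/- Let d < 0 be a squarefree integer and K = ℚ(√d) the corresponding imaginary quadratic field with ring of integers O_K. Then O_K is norm-Euclidean — i.e. for all α, β ∈ O_K with β ≠ 0 there exist q, r ∈ O_K with α = βq + r and N_{K/ℚ}(r) < N_{K/ℚ}(β) — if and only if d ∈ {−1, −2, −3, −7, −11}. -/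
open NumberField

namespace ImaginaryQuadratic

variable {K : Type*} [Field K] [NumberField K] {d : ℤ} {s : K}

/-- The family `1, s` is a basis of a quadratic field in which `s ^ 2` is a negative integer. -/
theorem exists_basis (hd : d < 0) (hs : s ^ 2 = (d : K)) (hdeg : Module.finrank ℚ K = 2) :
    ∃ b : Module.Basis (Fin 2) ℚ K, b 0 = 1 ∧ b 1 = s := by
  have hli : LinearIndependent ℚ ![(1 : K), s] := by
    rw [LinearIndependent.pair_iff' one_ne_zero]
    intro r hr
    have hrs : ((r ^ 2 : ℚ) : K) = ((d : ℚ) : K) := by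
      rw [Rat.smul_one_eq_cast] at hr
      push_cast
      rw [hr, hs]
    have hrd : r ^ 2 = (d : ℚ) := Rat.cast_injective hrs
    have hd' : (d : ℚ) < 0 := by exact_mod_cast hd
    nlinarith [sq_nonneg r]
  refine ⟨basisOfLinearIndependentOfCardEqFinrank hli (by simp [hdeg]), ?_, ?_⟩ <;> simp

theorem exists_eq_add_mul (hd : d < 0) (hs : s ^ 2 = (d : K)) (hdeg : Module.finrank ℚ K = 2)
    (x : K) : ∃ u v : ℚ, x = u + v * s := by
  obtain ⟨b, hb0, hb1⟩ := exists_basis hd hs hdeg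
  refine ⟨b.repr x 0, b.repr x 1, ?_⟩
  conv_lhs => rw [← b.sum_repr x]
  simp [Fin.sum_univ_two, hb0, hb1, Rat.smul_def]

theorem leftMulMatrix_add_mul (hs : s ^ 2 = (d : K)) (b : Module.Basis (Fin 2) ℚ K)
    (hb0 : b 0 = 1) (hb1 : b 1 = s) (u v : ℚ) :
    Algebra.leftMulMatrix b (u + v * s) = !![u, d * v; v, u] := by
  have hrepr (p q : ℚ) (i : Fin 2) : b.repr (p + q * s) i = ![p, q] i := by
    have : (p + q * s : K) = p • b 0 + q • b 1 := by simp [hb0, hb1, Rat.smul_def]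
    rw [this]
    fin_cases i <;> simp
  have hmul : (u + v * s) * s = ((d * v : ℚ) : K) + (u : K) * s := by
    push_cast
    linear_combination (v : K) * hs
  ext i j
  rw [Algebra.leftMulMatrix_eq_repr_mul]
  fin_cases j
  · simp only [Fin.zero_eta, hb0, mul_one, hrepr]
    fin_cases i <;> simp
  · simp only [Fin.mk_one, hb1, hmul, hrepr]
    fin_cases i <;> simp

theorem norm_add_mul (hd : d < 0) (hs : s ^ 2 = (d : K)) (hdeg : Module.finrank ℚ K = 2)
    (u v : ℚ) : Algebra.norm ℚ (u + v * s : K) = u ^ 2 - d * v ^ 2 := by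
  obtain ⟨b, hb0, hb1⟩ := exists_basis hd hs hdeg
  rw [Algebra.norm_eq_matrix_det b, leftMulMatrix_add_mul hs b hb0 hb1, Matrix.det_fin_two_of]
  ring

theorem trace_add_mul (hd : d < 0) (hs : s ^ 2 = (d : K)) (hdeg : Module.finrank ℚ K = 2)
    (u v : ℚ) : Algebra.trace ℚ K (u + v * s) = 2 * u := by
  obtain ⟨b, hb0, hb1⟩ := exists_basis hd hs hdeg
  rw [Algebra.trace_eq_matrix_trace b, leftMulMatrix_add_mul hs b hb0 hb1, Matrix.trace_fin_two_of]
  ring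

/-- If `d` is squarefree and `d * t ^ 2` is an integer, then so is `t`. -/
theorem exists_int_of_squarefree_mul_sq (hsf : Squarefree d) {t : ℚ} {c : ℤ}
    (h : d * t ^ 2 = (c : ℚ)) : ∃ n : ℤ, t = n := by
  have hd0 : (d : ℚ) ≠ 0 := by exact_mod_cast hsf.ne_zero
  have hint : IsIntegral ℤ ((d : ℚ) * t) := by
    refine IsIntegral.of_pow (n := 2) two_pos ?_
    have : ((d : ℚ) * t) ^ 2 = algebraMap ℤ ℚ (d * c) := by
      simp only [eq_intCast, Int.cast_mul, ← h]
      ring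
    rw [this]
    exact isIntegral_algebraMap
  obtain ⟨k, hk⟩ := IsIntegrallyClosed.isIntegral_iff.mp hint
  simp only [eq_intCast] at hk
  have hkd : d ∣ k ^ 2 := by
    refine ⟨c, ?_⟩
    have : (k : ℚ) ^ 2 = d * c := by
      rw [hk, ← h]
      ring
    exact_mod_cast this
  obtain ⟨n, rfl⟩ := (hsf.dvd_pow_iff_dvd two_ne_zero).mp hkd
  refine ⟨n, mul_left_cancel₀ hd0 ?_⟩
  rw [← hk]
  push_cast
  ring

theorem exists_half_integers (hd : d < 0) (hsf : Squarefree d) (hs : s ^ 2 = (d : K))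
    (hdeg : Module.finrank ℚ K = 2) (x : 𝓞 K) :
    ∃ m n : ℤ, (x : K) = ((m / 2 : ℚ) : K) + ((n / 2 : ℚ) : K) * s ∧ 4 ∣ m ^ 2 - d * n ^ 2 := by
  obtain ⟨u, v, huv⟩ := exists_eq_add_mul hd hs hdeg (x : K)
  have hx : IsIntegral ℤ (x : K) := RingOfIntegers.isIntegral_coe x
  obtain ⟨m, hm⟩ := IsIntegrallyClosed.isIntegral_iff.mp
    (Algebra.isIntegral_trace (L := ℚ) hx)
  obtain ⟨N, hN⟩ := IsIntegrallyClosed.isIntegral_iff.mp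
    (Algebra.isIntegral_norm ℚ hx)
  rw [huv, trace_add_mul hd hs hdeg] at hm
  rw [huv, norm_add_mul hd hs hdeg] at hN
  simp only [eq_intCast] at hm hN
  obtain ⟨n, hn⟩ := exists_int_of_squarefree_mul_sq hsf (t := 2 * v) (c := m ^ 2 - 4 * N) (by
    push_cast
    rw [hm, hN]
    ring)
  have hu : u = m / 2 := by linarith
  have hv : v = n / 2 := by linarith
  refine ⟨m, n, by rw [huv, hu, hv], N, ?_⟩
  rw [hu, hv] at hN
  have : (m : ℚ) ^ 2 - d * n ^ 2 = 4 * N := by linarith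
  exact_mod_cast this

theorem exists_ringOfIntegers_coe_eq (hs : s ^ 2 = (d : K)) {m n : ℤ}
    (h : 4 ∣ m ^ 2 - d * n ^ 2) :
    ∃ x : 𝓞 K, (x : K) = ((m / 2 : ℚ) : K) + ((n / 2 : ℚ) : K) * s := by
  obtain ⟨c, hc⟩ := h
  have hcK : (m : K) ^ 2 - d * n ^ 2 = 4 * c := by exact_mod_cast hc
  refine ⟨⟨((m / 2 : ℚ) : K) + ((n / 2 : ℚ) : K) * s,
    Polynomial.X ^ 2 - Polynomial.C m * Polynomial.X + Polynomial.C c, by monicity!, ?_⟩, rfl⟩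
  simp only [Polynomial.eval₂_add, Polynomial.eval₂_sub, Polynomial.eval₂_mul,
    Polynomial.eval₂_pow, Polynomial.eval₂_X, Polynomial.eval₂_C]
  simp only [eq_intCast]
  push_cast
  linear_combination (n : K) ^ 2 / 4 * hs - hcK / 4

theorem norm_sub_mul_lt (x y q : K) (hy : y ≠ 0) (hpos : 0 < Algebra.norm ℚ y)
    (h : Algebra.norm ℚ (x / y - q) < 1) : Algebra.norm ℚ (x - y * q) < Algebra.norm ℚ y := by
  have : x - y * q = y * (x / y - q) := by field_simp
  rw [this, map_mul]
  exact mul_lt_of_lt_one_right hpos h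

/-- Every point of the field is at norm distance less than one from an integer. -/
theorem exists_half_integers_near (hd : d = -1 ∨ d = -2 ∨ d = -3 ∨ d = -7 ∨ d = -11)
    (u v : ℚ) : ∃ m n : ℤ, 4 ∣ m ^ 2 - d * n ^ 2 ∧
      (u - m / 2) ^ 2 - d * (v - n / 2) ^ 2 < 1 := by
  by_cases hd2 : d = -1 ∨ d = -2
  · refine ⟨2 * round u, 2 * round v, ⟨round u ^ 2 - d * round v ^ 2, by ring⟩, ?_⟩
    have hu := sq_le_sq' (abs_le.mp (abs_sub_round u)).1 (abs_le.mp (abs_sub_round u)).2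
    have hv := sq_le_sq' (abs_le.mp (abs_sub_round v)).1 (abs_le.mp (abs_sub_round v)).2
    rcases hd2 with rfl | rfl <;> push_cast <;> ring_nf at hu hv ⊢ <;> linarith
  · set n := round (2 * v)
    set k := round (u - n / 2)
    refine ⟨2 * k + n, n, ?_, ?_⟩
    · obtain ⟨c, hc⟩ : ∃ c, d = 1 + 4 * c := by
        rcases hd with rfl | rfl | rfl | rfl | rfl
        · simp at hd2
        · simp at hd2
        · exact ⟨-1, rfl⟩
        · exact ⟨-2, rfl⟩
        · exact ⟨-3, rfl⟩
      exact ⟨k ^ 2 + k * n - c * n ^ 2, by rw [hc]; ring⟩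
    · have hu := abs_le.mp (abs_sub_round (u - n / 2))
      have hv := abs_le.mp (abs_sub_round (2 * v))
      have hu2 := sq_le_sq' hu.1 hu.2
      have hv2 := sq_le_sq' hv.1 hv.2
      change (u - n / 2 - (k : ℚ)) ^ 2 ≤ _ at hu2
      change (2 * v - (n : ℚ)) ^ 2 ≤ _ at hv2
      have hd11 : (-11 : ℚ) ≤ d := by
        rcases hd with rfl | rfl | rfl | rfl | rfl <;> norm_num
      push_cast
      nlinarith [sq_nonneg (v - n / 2 : ℚ)]

theorem eq_of_mod_four_ne_one (hd : d < 0) (hd4 : d % 4 = 2 ∨ d % 4 = 3)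
    {m n : ℤ} (hmn : 4 ∣ m ^ 2 - d * n ^ 2) (h : (1 - m) ^ 2 - d * (1 - n) ^ 2 < 4) :
    d = -1 ∨ d = -2 := by
  obtain ⟨hm, hn⟩ : Even m ∧ Even n := by
    rw [Int.even_iff, Int.even_iff]
    have h0 := Int.emod_eq_zero_of_dvd hmn
    rcases hd4 with e | e <;>
    rcases (by omega : m % 4 = 0 ∨ m % 4 = 1 ∨ m % 4 = 2 ∨ m % 4 = 3) with e1 | e1 | e1 | e1 <;>
    rcases (by omega : n % 4 = 0 ∨ n % 4 = 1 ∨ n % 4 = 2 ∨ n % 4 = 3) with e2 | e2 | e2 | e2 <;>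
    simp [pow_two, Int.sub_emod, Int.mul_emod, e, e1, e2] at h0 <;> omega
  have odd_sq (k : ℤ) (hk : Even k) : 1 ≤ (1 - k) ^ 2 := by
    obtain ⟨j, rfl⟩ := hk
    have : 1 - (j + j) ≠ 0 := by omega
    have := sq_pos_of_ne_zero this
    omega
  have h1 := odd_sq m hm
  have h2 := odd_sq n hn
  have : -3 < d := by nlinarith
  omega

theorem neg_fifteen_lt_of_mod_four_eq_one (hd4 : d % 4 = 1) {m n : ℤ}
    (hmn : 4 ∣ m ^ 2 - d * n ^ 2)
    (h : 4 * d ^ 2 * m ^ 2 - d * (1 - d + 2 * d * n) ^ 2 < 16 * d ^ 2) : -15 < d := by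
  by_contra! hd
  have hpar : Even m ↔ Even n := by
    have hev : Even (m ^ 2 - d * n ^ 2) := even_iff_two_dvd.mpr (dvd_trans (by norm_num) hmn)
    have hdo : ¬ Even d := by rw [Int.even_iff]; omega
    simpa [Int.even_sub, Int.even_mul, Int.even_pow, hdo] using hev
  have h' : -4 * d * m ^ 2 + (1 - d + 2 * d * n) ^ 2 < -16 * d := by nlinarith
  have hbig : -16 * d ≤ (1 - d) ^ 2 := by nlinarith
  by_cases hm : Even m
  · obtain ⟨j, rfl⟩ := hpar.mp hm
    obtain ⟨i, rfl⟩ := hm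
    rcases eq_or_ne i 0 with rfl | hi
    · have hsq : (1 - d) ^ 2 ≤ (1 - d + 2 * d * (j + j)) ^ 2 := by
        rw [sq_le_sq, abs_of_nonneg (by omega : 0 ≤ 1 - d), le_abs]
        rcases le_or_gt j 0 with hj | hj
        · left; nlinarith
        · right; nlinarith
      linarith
    · have := sq_pos_of_ne_zero hi
      nlinarith [sq_nonneg (1 - d + 2 * d * (j + j))]
  · have hn : ¬ Even n := fun hn => hm (hpar.mpr hn)
    have hm1 : 1 ≤ m ^ 2 := by
      have : m ≠ 0 := by rintro rfl; simp at hm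
      have := sq_pos_of_ne_zero this
      omega
    have hn1 : (1 + d) ^ 2 ≤ (1 - d + 2 * d * n) ^ 2 := by
      obtain ⟨j, rfl⟩ := Int.not_even_iff_odd.mp hn
      rw [sq_le_sq, abs_of_nonpos (by omega : 1 + d ≤ 0), le_abs]
      rcases le_or_gt 0 j with hj | hj
      · right; nlinarith
      · left; nlinarith
    nlinarith

end ImaginaryQuadratic

open ImaginaryQuadratic in
/-- The imaginary quadratic fields `K = ℚ(√d)` (`d < 0` squarefree) whose ring of
integers is norm-Euclidean are precisely those with `d ∈ {-1, -2, -3, -7, -11}`. -/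
theorem norm_euclidean_iff
    {K : Type*} [Field K] [NumberField K]
    (d : ℤ) (hd : d < 0) (hsf : Squarefree d)
    (sqrtd : K) (hsq : sqrtd ^ 2 = (d : K))
    (hdeg : Module.finrank ℚ K = 2) :
    (∀ α β : 𝓞 K, β ≠ 0 → ∃ q r : 𝓞 K, α = β * q + r ∧
        Algebra.norm ℤ r < Algebra.norm ℤ β) ↔
      d = -1 ∨ d = -2 ∨ d = -3 ∨ d = -7 ∨ d = -11 := by
  have coe_norm (x : 𝓞 K) : ((Algebra.norm ℤ x : ℤ) : ℚ) = Algebra.norm ℚ (x : K) :=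
    Algebra.coe_norm_int x
  constructor
  · intro h
    -- `(a + b * sqrtd) / c` is at norm distance less than one from an integer of `K`
    have approx (a b c : ℤ) (hc : c ≠ 0) : ∃ m n : ℤ, 4 ∣ m ^ 2 - d * n ^ 2 ∧
        (a - c * m / 2 : ℚ) ^ 2 - d * (b - c * n / 2 : ℚ) ^ 2 < c ^ 2 := by
      obtain ⟨w, hw⟩ := exists_ringOfIntegers_coe_eq (m := 2 * a) (n := 2 * b) hsq
        ⟨a ^ 2 - d * b ^ 2, by ring⟩
      obtain ⟨q, r, hqr, hlt⟩ := h w (c : 𝓞 K) (by exact_mod_cast hc)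
      obtain ⟨m, n, hq, hmn⟩ := exists_half_integers hd hsf hsq hdeg q
      refine ⟨m, n, hmn, ?_⟩
      have hr : (r : K) = ((a - c * m / 2 : ℚ) : K) + ((b - c * n / 2 : ℚ) : K) * sqrtd := by
        have hqr' : (w : K) = c * q + r := by rw [hqr]; simp
        rw [hw, hq] at hqr'
        push_cast at hqr' ⊢
        linear_combination -hqr'
      have hcK : (((c : 𝓞 K)) : K) = ((c : ℚ) : K) + ((0 : ℚ) : K) * sqrtd := by simp
      have hlt' : ((Algebra.norm ℤ r : ℤ) : ℚ) < (Algebra.norm ℤ (c : 𝓞 K) : ℤ) := by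
        exact_mod_cast hlt
      rw [coe_norm, coe_norm, hr, hcK, norm_add_mul hd hsq hdeg, norm_add_mul hd hsq hdeg] at hlt'
      simpa using hlt'
    have h0 : d % 4 ≠ 0 := by
      intro h0
      have h2 := hsf 2 (Int.dvd_of_emod_eq_zero h0)
      norm_num [Int.isUnit_iff] at h2
    by_cases h1 : d % 4 = 1
    · obtain ⟨m, n, hmn, hlt⟩ := approx 0 (1 - d) (-4 * d) (by omega)
      have hlt' : 4 * d ^ 2 * m ^ 2 - d * (1 - d + 2 * d * n) ^ 2 < 16 * d ^ 2 := by
        have : (4 * d ^ 2 * m ^ 2 - d * (1 - d + 2 * d * n) ^ 2 : ℚ) < 16 * d ^ 2 := by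
          push_cast at hlt
          ring_nf at hlt ⊢
          exact hlt
        exact_mod_cast this
      have := neg_fifteen_lt_of_mod_four_eq_one h1 hmn hlt'
      omega
    · obtain ⟨m, n, hmn, hlt⟩ := approx 1 1 2 two_ne_zero
      have hlt' : (1 - m) ^ 2 - d * (1 - n) ^ 2 < 4 := by
        have : ((1 - m) ^ 2 - d * (1 - n) ^ 2 : ℚ) < 4 := by
          push_cast at hlt
          ring_nf at hlt ⊢
          exact hlt
        exact_mod_cast this
      have := eq_of_mod_four_ne_one hd (by omega) hmn hlt'
      omega
  · intro hcases α β hβ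
    have hβK : (β : K) ≠ 0 := RingOfIntegers.coe_ne_zero_iff.mpr hβ
    have hpos : 0 < Algebra.norm ℚ (β : K) := by
      refine lt_of_le_of_ne ?_ (Algebra.norm_ne_zero_iff.mpr hβK).symm
      obtain ⟨u, v, huv⟩ := exists_eq_add_mul hd hsq hdeg (β : K)
      rw [huv, norm_add_mul hd hsq hdeg]
      have hd' : (d : ℚ) < 0 := by exact_mod_cast hd
      nlinarith [sq_nonneg u, sq_nonneg v]
    obtain ⟨u, v, huv⟩ := exists_eq_add_mul hd hsq hdeg (α / β : K)
    obtain ⟨m, n, hmn, hlt⟩ := exists_half_integers_near hcases u v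
    obtain ⟨q, hq⟩ := exists_ringOfIntegers_coe_eq hsq hmn
    refine ⟨q, α - β * q, by ring, ?_⟩
    have key : Algebra.norm ℚ (α - β * q : K) < Algebra.norm ℚ (β : K) := by
      refine norm_sub_mul_lt _ _ _ hβK hpos ?_
      have : (α / β - q : K) = ((u - m / 2 : ℚ) : K) + ((v - n / 2 : ℚ) : K) * sqrtd := by
        rw [huv, hq]
        push_cast
        ring
      rwa [this, norm_add_mul hd hsq hdeg]
    have hcast : ((Algebra.norm ℤ (α - β * q) : ℤ) : ℚ) < (Algebra.norm ℤ β : ℤ) := by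
      rw [coe_norm, coe_norm]
      simpa using key
    exact_mod_cast hcast
end
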